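/- Let G be a group with proper length function ℓ, let (N_n)_{n∈ℕ} be normal subgroups of G, equip each quotient G/N_n with the quotient length induced by ℓ, and let π_n : G → G/N_n be the quotient maps. Let (H_τ)_{τ∈ℕ} be subgroups of G converging to G, i.e. for every R > 0 there is T such that {g ∈ G : ℓ(g) ≤ R} ⊆ H_τ for all τ ≥ T. If for every τ the sequence of subspaces (π_n(H_τ) ⊆ G/N_n)_{n∈ℕ}, with the metrics inherited from G/N_n, coarsely embeds uniformly into Hilbert space (with control functions that may depend on τ), then the sequence (G/N_n)_{n∈ℕ} coarsely embeds uniformly into Hilbert space. -/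

import Mathlib

/-- A length function on a group. -/
structure IsLengthFunction {G : Type*} [Group G] (ℓ : G → ℝ) : Prop where
  nonneg : ∀ g, 0 ≤ ℓ g
  eq_zero_iff : ∀ g, ℓ g = 0 ↔ g = 1
  inv_eq : ∀ g, ℓ g⁻¹ = ℓ g
  subadd : ∀ g h, ℓ (g * h) ≤ ℓ g + ℓ h

/-- A proper length function: balls are finite. -/
def IsProperLength {G : Type*} [Group G] (ℓ : G → ℝ) : Prop :=
  IsLengthFunction ℓ ∧ ∀ R : ℝ, {g : G | ℓ g ≤ R}.Finite

/-- The quotient length on the coset space `G ⧸ N`: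
`ℓ̄(gN) = inf {ℓ(g') : g'N = gN} = inf {ℓ(gh) : h ∈ N}`. -/
noncomputable def quotLength {G : Type*} [Group G] (ℓ : G → ℝ) (N : Subgroup G) :
    G ⧸ N → ℝ :=
  fun x => sInf {r : ℝ | ∃ g : G, QuotientGroup.mk g = x ∧ ℓ g = r}

/-- The quotient metric on the coset space `G ⧸ N` induced by a length function `ℓ`:
`d̄(xN, yN) = inf {ℓ(g⁻¹h) : gN = xN, hN = yN}`; for normal `N` this is the metric of the
quotient length. -/
noncomputable def quotDist {G : Type*} [Group G] (ℓ : G → ℝ) (N : Subgroup G) :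
    G ⧸ N → G ⧸ N → ℝ :=
  fun x y => sInf {r : ℝ | ∃ g h : G,
    QuotientGroup.mk g = x ∧ QuotientGroup.mk h = y ∧ ℓ (g⁻¹ * h) = r}

/-- A family of spaces (with given distance functions) coarsely embeds uniformly into
Hilbert space: there are real Hilbert spaces `H j`, maps `F j`, and common nondecreasing
control functions `ρ₋, ρ₊` with `ρ₋ → ∞`. -/
def UnifCoarseEmbedHilbert {J : Type*} (X : J → Type*) (d : ∀ j, X j → X j → ℝ) : Prop :=
  ∃ (H : J → Type) (iN : ∀ j, NormedAddCommGroup (H j))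
    (_ : ∀ j, @InnerProductSpace ℝ (H j) inferInstance (iN j).toSeminormedAddCommGroup)
    (_ : ∀ j, @CompleteSpace (H j) (iN j).toMetricSpace.toPseudoMetricSpace.toUniformSpace)
    (F : ∀ j, X j → H j) (ρm ρp : ℝ → ℝ),
    Monotone ρm ∧ Monotone ρp ∧
    Filter.Tendsto ρm Filter.atTop Filter.atTop ∧
    ∀ (j : J) (x y : X j),
      ρm (d j x y) ≤ @dist (H j) (iN j).toMetricSpace.toPseudoMetricSpace.toDist (F j x) (F j y) ∧
      @dist (H j) (iN j).toMetricSpace.toPseudoMetricSpace.toDist (F j x) (F j y) ≤ ρp (d j x y)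

/-- Residual finiteness: every nontrivial element survives in some finite quotient
(equivalently, has nontrivial image under some homomorphism to a finite group). -/
def ResiduallyFinite (G : Type*) [Group G] : Prop :=
  ∀ g : G, g ≠ 1 → ∃ N : Subgroup G, N.Normal ∧ N.FiniteIndex ∧ g ∉ N

/-- Amenability via Reiter's ℓ²-condition: almost-invariant unit vectors in `ℓ²(G)`. -/
def ReiterAmenable (G : Type*) [Group G] : Prop :=
  ∀ (F : Finset G) (ε : ℝ), 0 < ε →
    ∃ ξ : G → ℝ, Summable (fun x => ξ x ^ 2) ∧ (∑' x, ξ x ^ 2) = 1 ∧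
      ∀ g ∈ F, (∑' x, (ξ (g⁻¹ * x) - ξ x) ^ 2) ≤ ε ^ 2

/-- The Schreier metric on the coset space `G ⧸ H` with respect to a (symmetric) set `S`:
the least `m` such that `y = s_m ⋯ s_1 • x` with all `s_i ∈ S`. -/
noncomputable def schreierDist {G : Type*} [Group G] (S : Set G) (H : Subgroup G)
    (x y : G ⧸ H) : ℝ :=
  sInf {r : ℝ | ∃ m : ℕ, r = m ∧ ∃ w : Fin m → G, (∀ i, w i ∈ S) ∧
    (List.ofFn w).prod • x = y}

/-- The word length with respect to a generating set `S` (closed under inverses). -/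
noncomputable def wordLength {G : Type*} [Group G] (S : Set G) (g : G) : ℝ :=
  sInf {r : ℝ | ∃ m : ℕ, r = m ∧ ∃ w : Fin m → G, (∀ i, w i ∈ S) ∧
    (List.ofFn w).prod = g}

/-- The Cheeger constant of a finite `G`-set `V` with respect to `S ⊆ G`:
`min {|∂_S A| / |A| : A ⊆ V nonempty, 2|A| ≤ |V|}`, where
`∂_S A = {(v, s) ∈ A × S : s • v ∉ A}`. -/
noncomputable def cheegerConst {G : Type*} [Group G] (S : Finset G)
    (V : Type*) [MulAction G V] : ℝ :=
  sInf {r : ℝ | ∃ A : Set V, A.Nonempty ∧ 2 * A.ncard ≤ Nat.card V ∧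
    r = (Set.ncard {p : V × G | p.1 ∈ A ∧ p.2 ∈ (S : Set G) ∧ p.2 • p.1 ∉ A} : ℝ) / A.ncard}

/-- Equi-exactness (uniform exactness) of a family of spaces: uniformly bounded,
uniformly Lipschitz partitions of unity. -/
def EquiExact {J : Type*} (X : J → Type*) (d : ∀ j, X j → X j → ℝ) : Prop :=
  ∀ R > (0:ℝ), ∀ ε > (0:ℝ), ∃ C > (0:ℝ), ∀ j, ∃ (I : Type) (φ : I → X j → ℝ),
    (∀ i x, 0 ≤ φ i x ∧ φ i x ≤ 1) ∧
    (∀ x, HasSum (fun i => φ i x) 1) ∧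
    (∀ x y, d j x y ≤ R → ∃ s ≤ ε, HasSum (fun i => |φ i x - φ i y|) s) ∧
    (∀ i x y, φ i x ≠ 0 → φ i y ≠ 0 → d j x y ≤ C)

/-- `k` is the Gram kernel of a map to a Hilbert space. -/
def IsKer {X : Type*} (k : X → X → ℝ) : Prop :=
  ∃ (K : Type) (_ : NormedAddCommGroup K) (_ : InnerProductSpace ℝ K) (_ : CompleteSpace K)
    (T : X → K), ∀ x y, inner ℝ (T x) (T y) = k x y

theorem IsKer.comp {X Y : Type*} {k : X → X → ℝ} (h : IsKer k) (f : Y → X) :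
    IsKer (fun x y => k (f x) (f y)) := by
  obtain ⟨K, i1, i2, i3, T, hT⟩ := h
  exact ⟨K, i1, i2, i3, fun y => T (f y), fun x y => hT _ _⟩

theorem IsKer.scale {X : Type*} {k : X → X → ℝ} (h : IsKer k) (f : X → ℝ) :
    IsKer (fun x y => f x * f y * k x y) := by
  obtain ⟨K, i1, i2, i3, T, hT⟩ := h
  refine ⟨K, i1, i2, i3, fun y => f y • T y, fun x y => ?_⟩
  rw [inner_smul_left, inner_smul_right, hT]
  simp
  ring

/-- recentering a kernel at a base point -/
theorem IsKer.recenter {X : Type*} {k : X → X → ℝ} (h : IsKer k) (o : X) :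
    IsKer (fun x y => k x y - k x o - k o y + k o o) := by
  obtain ⟨K, i1, i2, i3, T, hT⟩ := h
  refine ⟨K, i1, i2, i3, fun y => T y - T o, fun x y => ?_⟩
  rw [inner_sub_left, inner_sub_right, inner_sub_right, hT, hT, hT, hT]
  ring

theorem isKer_sum {X : Type*} {ι : Type} {k : ι → X → X → ℝ} (h : ∀ i, IsKer (k i))
    (hs : ∀ x, Summable (fun i => k i x x)) :
    ∃ s : X → X → ℝ, IsKer s ∧ ∀ x y, HasSum (fun i => k i x y) (s x y) := by
  choose K i1 i2 i3 T hT using h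
  have hmem : ∀ x, Memℓp (fun i => T i x) 2 := by
    intro x
    apply memℓp_gen
    refine (hs x).congr ?_
    intro i
    rw [← hT i, real_inner_self_eq_norm_sq]
    norm_num
  refine ⟨fun x y => inner ℝ (⟨_, hmem x⟩ : lp K 2) (⟨_, hmem y⟩ : lp K 2), 
    ⟨lp K 2, inferInstance, inferInstance, inferInstance, fun x => ⟨_, hmem x⟩, fun x y => rfl⟩, ?_⟩
  intro x y
  have := lp.hasSum_inner (𝕜 := ℝ) (⟨_, hmem x⟩ : lp K 2) (⟨_, hmem y⟩ : lp K 2)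
  refine this.congr_fun ?_
  intro i
  exact (hT i x y).symm

theorem isKer_hasSum {X : Type*} {ι : Type} {k : ι → X → X → ℝ} {s : X → X → ℝ}
    (h : ∀ i, IsKer (k i)) (hs : ∀ x y, HasSum (fun i => k i x y) (s x y)) : IsKer s := by
  obtain ⟨s', h1, h2⟩ := isKer_sum h (fun x => (hs x x).summable)
  have : s = s' := by
    funext x y
    exact (hs x y).unique (h2 x y)
  rwa [this]

theorem isKer_pow {E : Type} [NormedAddCommGroup E] [InnerProductSpace ℝ E] [CompleteSpace E]
    (n : ℕ) : IsKer (fun u v : E => (inner ℝ u v) ^ n) := by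
  induction n with
  | zero => exact ⟨ℝ, inferInstance, inferInstance, inferInstance, fun _ => 1, by simp⟩
  | succ n ih =>
    obtain ⟨w, b, hb⟩ := exists_hilbertBasis ℝ E
    refine isKer_hasSum (ι := w) (k := fun i u v => inner ℝ u (b i) * inner ℝ v (b i) * 
      inner ℝ u v ^ n) (fun i => ih.scale (fun u => inner ℝ u (b i))) ?_
    intro u v
    have := (b.hasSum_inner_mul_inner u v).mul_right (inner ℝ u v ^ n)
    rw [pow_succ']
    refine this.congr_fun ?_
    intro i
    simp only [real_inner_comm]

theorem isKer_gauss {E : Type} [NormedAddCommGroup E] [InnerProductSpace ℝ E] [CompleteSpace E]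
    (s : ℝ) : IsKer (fun u v : E => Real.exp (-(s ^ 2 * dist u v ^ 2))) := by
  have key : IsKer (fun u v : E => Real.exp (2 * s ^ 2 * inner ℝ u v)) := by
    refine isKer_hasSum (ι := ℕ) (k := fun n u v => 
      Real.sqrt ((2 * s ^ 2) ^ n / n.factorial) * Real.sqrt ((2 * s ^ 2) ^ n / n.factorial)
        * inner ℝ u v ^ n) (fun n => (isKer_pow n).scale (fun _ => _)) ?_
    intro u v
    have := NormedSpace.expSeries_div_hasSum_exp (2 * s ^ 2 * inner ℝ u v)
    rw [← Real.exp_eq_exp_ℝ] at this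
    refine this.congr_fun ?_
    intro n
    rw [Real.mul_self_sqrt (by positivity), mul_pow _ (inner ℝ u v)]
    ring
  have := key.scale (fun u => Real.exp (-(s ^ 2 * ‖u‖ ^ 2)))
  convert this using 3 with u v
  rw [← Real.exp_add, ← Real.exp_add, dist_eq_norm, @norm_sub_sq_real]
  congr 1
  ring

theorem isKer_coset {X : Type*} {k : X → X → ℝ} (h : IsKer k) (c : X → ℕ) :
    IsKer (fun x y => if c x = c y then k x y else 0) := by
  refine isKer_hasSum (ι := ℕ) (k := fun n x y => 
    (if c x = n then 1 else 0) * (if c y = n then 1 else 0) * k x y)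
    (fun n => h.scale (fun x => if c x = n then 1 else 0)) ?_
  intro x y
  convert hasSum_single (c x) ?_ using 1
  · by_cases h : c x = c y
    · simp [h]
    · simp [h, Ne.symm h]
  · intro n hn
    simp [hn.symm]

/-- Gluing lemma. -/
theorem unif_of_kernels {J : Type*} (X : J → Type*) (d : ∀ j, X j → X j → ℝ)
    (ne : ∀ j, Nonempty (X j))
    (hk : ∀ m : ℕ, ∃ (S : ℝ) (k : ∀ j, X j → X j → ℝ), ∀ j, IsKer (k j) ∧ ∀ x y,
      (k j x x + k j y y - 2 * k j x y ≤ 2) ∧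
      (d j x y ≤ m → k j x x + k j y y - 2 * k j x y ≤ (1 / 2) ^ m) ∧
      (S ≤ d j x y → 1 ≤ k j x x + k j y y - 2 * k j x y)) :
    UnifCoarseEmbedHilbert X d := by
  choose S k hk using hk
  -- squared distances at level m
  set D : ℕ → ∀ j, X j → X j → ℝ := fun m j x y => k m j x x + k m j y y - 2 * k m j x y with hD
  have hD0 : ∀ m j x y, 0 ≤ D m j x y := by
    intro m j x y
    obtain ⟨K, i1, i2, i3, T, hT⟩ := (hk m j).1
    have : D m j x y = ‖T x - T y‖ ^ 2 := by
      rw [@norm_sub_sq_real, ← real_inner_self_eq_norm_sq, ← real_inner_self_eq_norm_sq,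
        hT, hT, hT, hD]
      ring
    rw [this]; positivity
  have hDle : ∀ m j x y, D m j x y ≤ (if m ∈ Finset.range ⌈d j x y⌉₊ then 2 else 0) + (1 / 2) ^ m := by
    intro m j x y
    have h := (hk m j).2 x y
    split_ifs with hm
    · exact h.1.trans (by simp)
    · rw [zero_add]
      refine h.2.1 ?_
      rw [Finset.mem_range, not_lt] at hm
      exact Nat.ceil_le.mp hm
  have hsb : ∀ t : ℝ, HasSum (fun m : ℕ => (if m ∈ Finset.range ⌈t⌉₊ then (2:ℝ) else 0) + (1 / 2) ^ m)
      (⌈t⌉₊ * 2 + 2) := by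
    intro t
    refine HasSum.add ?_ hasSum_geometric_two
    have := hasSum_sum_of_ne_finset_zero (L := SummationFilter.unconditional ℕ) (s := Finset.range ⌈t⌉₊) 
      (f := fun m : ℕ => (if m ∈ Finset.range ⌈t⌉₊ then (2:ℝ) else 0)) (by
        intro b hb; rw [if_neg hb])
    rwa [Finset.sum_ite_mem, Finset.inter_self, Finset.sum_const, Finset.card_range, nsmul_eq_mul] at this
  have hDs : ∀ j x y, Summable (fun m => D m j x y) := fun j x y =>
    Summable.of_nonneg_of_le (fun m => hD0 m j x y) (fun m => hDle m j x y) (hsb _).summable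
  have main : ∀ j, ∃ (K : Type) (_ : NormedAddCommGroup K) (_ : InnerProductSpace ℝ K)
      (_ : CompleteSpace K) (T : X j → K), ∀ x y, HasSum (fun m => D m j x y) (dist (T x) (T y) ^ 2) := by
    intro j
    obtain ⟨o⟩ := ne j
    obtain ⟨s, ⟨K, i1, i2, i3, T, hT⟩, hs⟩ := isKer_sum
      (k := fun m x y => k m j x y - k m j x o - k m j o y + k m j o o)
      (fun m => (hk m j).1.recenter o) (by
        intro x
        refine (hDs j x o).congr ?_
        intro m
        obtain ⟨K, i1, i2, i3, T, hT⟩ := (hk m j).1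
        simp only [hD, ← hT]
        rw [real_inner_comm (T x) (T o)]
        ring)
    refine ⟨K, i1, i2, i3, T, fun x y => ?_⟩
    have h := ((hs x x).add (hs y y)).sub ((hs x y).mul_left 2)
    have e : s x x + s y y - 2 * s x y = dist (T x) (T y) ^ 2 := by
      rw [dist_eq_norm, @norm_sub_sq_real, ← real_inner_self_eq_norm_sq,
        ← real_inner_self_eq_norm_sq, hT, hT, hT]
      ring
    rw [e] at h
    refine h.congr_fun ?_
    intro m
    obtain ⟨K, i1, i2, i3, T, hT⟩ := (hk m j).1
    simp only [hD, ← hT]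
    rw [real_inner_comm (T x) (T o), real_inner_comm (T y) (T o)]
    ring
  choose K i1 i2 i3 T hT using main
  refine ⟨K, i1, i2, i3, T,
    fun t => Real.sqrt (((Finset.range ⌈t⌉₊).filter (fun m => S m ≤ t)).card),
    fun t => Real.sqrt (⌈t⌉₊ * 2 + 2), ?_, ?_, ?_, ?_⟩
  · intro a b hab
    apply Real.sqrt_le_sqrt
    norm_cast
    apply Finset.card_le_card
    intro m hm
    simp only [Finset.mem_filter, Finset.mem_range] at hm ⊢
    exact ⟨hm.1.trans_le (Nat.ceil_mono hab), hm.2.trans hab⟩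
  · intro a b hab
    apply Real.sqrt_le_sqrt
    have : (⌈a⌉₊ : ℝ) ≤ ⌈b⌉₊ := by exact_mod_cast Nat.ceil_mono hab
    linarith
  · refine Real.tendsto_sqrt_atTop.comp (tendsto_natCast_atTop_atTop.comp ?_)
    rw [Filter.tendsto_atTop]
    intro n
    have h1 : ∀ᶠ t : ℝ in Filter.atTop, ∀ m ∈ Finset.range n, S m ≤ t := by
      rw [Filter.eventually_all_finset]
      intro m _
      exact Filter.eventually_ge_atTop _
    filter_upwards [h1, Filter.eventually_ge_atTop (n : ℝ)] with t ht1 ht2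
    calc n = (Finset.range n).card := by simp
      _ ≤ _ := by
        apply Finset.card_le_card
        intro m hm
        simp only [Finset.mem_filter, Finset.mem_range] at hm ⊢
        refine ⟨hm.trans_le ?_, ht1 m (by simpa using hm)⟩
        exact_mod_cast ht2.trans (Nat.le_ceil t)
  · intro j x y
    constructor
    · apply Real.sqrt_le_iff.mpr
      refine ⟨dist_nonneg, ?_⟩
      refine le_trans ?_ (sum_le_hasSum ((Finset.range ⌈d j x y⌉₊).filter (fun m => S m ≤ d j x y))
        (fun m _ => hD0 m j x y) (hT j x y))
      have := Finset.card_nsmul_le_sum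
        ((Finset.range ⌈d j x y⌉₊).filter (fun m => S m ≤ d j x y)) (fun m => D m j x y) 1 (by
          intro m hm
          exact ((hk m j).2 x y).2.2 (Finset.mem_filter.mp hm).2)
      simpa using this
    · apply Real.le_sqrt_of_sq_le
      exact hasSum_le (fun m => hDle m j x y) (hT j x y) (hsb _)

theorem quotDist_mul_left {G : Type*} [Group G] (ℓ : G → ℝ) (N : Subgroup G) [N.Normal]
    (a x y : G ⧸ N) : quotDist ℓ N (a * x) (a * y) = quotDist ℓ N x y := by
  obtain ⟨a, rfl⟩ := QuotientGroup.mk_surjective a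
  unfold quotDist
  congr 1
  ext r
  constructor
  · rintro ⟨g, h, hg, hh, e⟩
    refine ⟨a⁻¹ * g, a⁻¹ * h, ?_, ?_, ?_⟩
    · rw [QuotientGroup.mk_mul, hg, QuotientGroup.mk_inv, inv_mul_cancel_left]
    · rw [QuotientGroup.mk_mul, hh, QuotientGroup.mk_inv, inv_mul_cancel_left]
    · rw [← e]; congr 1; group
  · rintro ⟨g, h, hg, hh, e⟩
    refine ⟨a * g, a * h, ?_, ?_, ?_⟩
    · rw [QuotientGroup.mk_mul, hg]
    · rw [QuotientGroup.mk_mul, hh]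
    · rw [← e]; congr 1; group

theorem mem_of_quotDist_lt {G : Type*} [Group G] (ℓ : G → ℝ) (N : Subgroup G) [N.Normal]
    (H : Subgroup G) {R : ℝ} (hR : ∀ g, ℓ g ≤ R → g ∈ H) (x y : G ⧸ N)
    (h : quotDist ℓ N x y < R) : x⁻¹ * y ∈ H.map (QuotientGroup.mk' N) := by
  obtain ⟨g0, rfl⟩ := QuotientGroup.mk_surjective x
  obtain ⟨h0, rfl⟩ := QuotientGroup.mk_surjective y
  unfold quotDist at h
  obtain ⟨r, ⟨g, h, hg, hh, e⟩, hr⟩ := exists_lt_of_csInf_lt (by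
    exact ⟨_, g0, h0, rfl, rfl, rfl⟩) h
  refine ⟨g⁻¹ * h, hR _ (by rw [e]; exact hr.le), ?_⟩
  rw [← hg, ← hh]
  rfl

theorem countable_of_proper {G : Type*} [Group G] (ℓ : G → ℝ) (hℓ : IsProperLength ℓ) :
    Countable G := by
  rw [← Set.countable_univ_iff]
  have : (Set.univ : Set G) = ⋃ n : ℕ, {g : G | ℓ g ≤ n} := by
    ext g
    simpa using exists_nat_ge (ℓ g)
  rw [this]
  exact Set.countable_iUnion (fun n => (hℓ.2 n).countable)

/-- Direct-limit stability for coarse disjoint unions of quotients: if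
subgroups `H_τ` converge to `(G, ℓ)` and for each `τ` the images `π_n(H_τ) ⊆ G ⧸ N_n`
embed uniformly, then the quotients `G ⧸ N_n` embed uniformly. -/
theorem statement16 {G : Type*} [Group G] (ℓ : G → ℝ) (hℓ : IsProperLength ℓ)
    (N : ℕ → Subgroup G) (hN : ∀ n, (N n).Normal)
    (H : ℕ → Subgroup G)
    (hconv : ∀ R > (0:ℝ), ∃ T, ∀ τ ≥ T, ∀ g : G, ℓ g ≤ R → g ∈ H τ)
    (hembed : ∀ τ, UnifCoarseEmbedHilbert
      (fun n => {x : G ⧸ N n // ∃ h ∈ H τ, QuotientGroup.mk h = x})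
      (fun n x y => quotDist ℓ (N n) x.1 y.1)) :
    UnifCoarseEmbedHilbert (fun n => G ⧸ N n) (fun n => quotDist ℓ (N n)) := by
  have hcount := countable_of_proper ℓ hℓ
  apply unif_of_kernels _ _ (fun n => inferInstance)
  intro m
  obtain ⟨τ, hτ⟩ := hconv (m + 1) (by positivity)
  have hτ := hτ τ le_rfl
  obtain ⟨K, i1, i2, i3, F, ρm, ρp, hm, hp, hlim, hF⟩ := hembed τ
  -- the scale
  obtain ⟨s, hs0, hs⟩ : ∃ s : ℝ, 0 < s ∧ 2 * (s ^ 2 * ρp m ^ 2) ≤ (1 / 2) ^ m := by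
    have hc : Filter.Tendsto (fun s : ℝ => 2 * (s ^ 2 * ρp m ^ 2)) (nhdsWithin 0 (Set.Ioi 0))
        (nhds 0) := by
      have : Continuous (fun s : ℝ => 2 * (s ^ 2 * ρp m ^ 2)) := by fun_prop
      have := this.tendsto 0
      simp only [ne_eq, OfNat.ofNat_ne_zero, not_false_eq_true, zero_pow, zero_mul, mul_zero] at this
      exact this.mono_left nhdsWithin_le_nhds
    have h0 : (0 : ℝ) < (1 / 2 : ℝ) ^ m := by positivity
    have h1 := hc.eventually (eventually_le_nhds h0)
    obtain ⟨s, h1, h2⟩ := (h1.and self_mem_nhdsWithin).exists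
    exact ⟨s, h2, h1⟩
  obtain ⟨S, hS⟩ := Filter.eventually_atTop.mp (hlim.eventually_ge_atTop (1 / s))
  let Hb : ∀ n, Subgroup (G ⧸ N n) := fun n => (H τ).map (QuotientGroup.mk' (N n))
  let c0 : ∀ n, G ⧸ N n → (G ⧸ N n) ⧸ Hb n := fun n x => QuotientGroup.mk x
  have hcc : ∀ n, Countable ((G ⧸ N n) ⧸ Hb n) := fun n =>
    (QuotientGroup.mk_surjective.comp (QuotientGroup.mk_surjective (s := N n))).countable
  choose e he using fun n => exists_injective_nat ((G ⧸ N n) ⧸ Hb n)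
  have hmem : ∀ n (x : G ⧸ N n), ∃ h ∈ H τ, QuotientGroup.mk h = ((c0 n x).out)⁻¹ * x := by
    intro n x
    have : ((c0 n x).out)⁻¹ * x ∈ Hb n := by
      rw [← QuotientGroup.eq]
      exact Quotient.out_eq _
    obtain ⟨h, h1, h2⟩ := this
    exact ⟨h, h1, h2⟩
  let Φ : ∀ n, G ⧸ N n → K n := fun n x => F n ⟨((c0 n x).out)⁻¹ * x, hmem n x⟩
  refine ⟨S, fun n x y => if e n (c0 n x) = e n (c0 n y) then
    Real.exp (-(s ^ 2 * dist (Φ n x) (Φ n y) ^ 2)) else 0, fun n =>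
    ⟨isKer_coset ((isKer_gauss s).comp (Φ n)) (fun x => e n (c0 n x)), fun x y => ?_⟩⟩
  simp only [if_true, dist_self]
  have e0 : Real.exp (-(s ^ 2 * (0:ℝ) ^ 2)) = 1 := by simp
  rw [e0]
  by_cases hxy : c0 n x = c0 n y
  · rw [if_pos (by rw [hxy])]
    have hd := hF n ⟨((c0 n x).out)⁻¹ * x, hmem n x⟩ ⟨((c0 n y).out)⁻¹ * y, hmem n y⟩
    have hq : quotDist ℓ (N n) (((c0 n x).out)⁻¹ * x) (((c0 n y).out)⁻¹ * y) = quotDist ℓ (N n) x y := by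
      rw [hxy, quotDist_mul_left]
    simp only [hq] at hd
    change _ ≤ dist (Φ n x) (Φ n y) ∧ dist (Φ n x) (Φ n y) ≤ _ at hd
    have hpos : 0 ≤ dist (Φ n x) (Φ n y) := dist_nonneg
    refine ⟨?_, ?_, ?_⟩
    · have := Real.exp_pos (-(s ^ 2 * dist (Φ n x) (Φ n y) ^ 2))
      linarith
    · intro hle
      have h1 := Real.add_one_le_exp (-(s ^ 2 * dist (Φ n x) (Φ n y) ^ 2))
      have h2 : dist (Φ n x) (Φ n y) ≤ ρp m := hd.2.trans (hp hle)
      have h3 : s ^ 2 * dist (Φ n x) (Φ n y) ^ 2 ≤ s ^ 2 * ρp m ^ 2 := by gcongr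
      linarith
    · intro hle
      have h1 : 1 / s ≤ dist (Φ n x) (Φ n y) := (hS _ hle).trans hd.1
      have h2 : 1 ≤ s * dist (Φ n x) (Φ n y) := by
        rw [div_le_iff₀ hs0] at h1
        linarith
      have h3 : 1 ≤ s ^ 2 * dist (Φ n x) (Φ n y) ^ 2 := by
        rw [← mul_pow]
        exact one_le_pow₀ h2
      have h4 : Real.exp (-(s ^ 2 * dist (Φ n x) (Φ n y) ^ 2)) ≤ Real.exp (-1) :=
        Real.exp_le_exp.mpr (by linarith)
      have h5 : Real.exp (-1) < 1 / 2 := by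
        have := Real.exp_neg_one_lt_d9
        linarith
      linarith
  · rw [if_neg (fun h => hxy (he n h))]
    refine ⟨by norm_num, ?_, by norm_num⟩
    intro hle
    exfalso
    apply hxy
    apply QuotientGroup.eq.mpr
    exact mem_of_quotDist_lt ℓ (N n) (H τ) hτ x y (by linarith)
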